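/- Let A be a (possibly non-unital) C*-algebra and P its Pedersen ideal. The map sending a closed *-ideal I of the *-algebra P (i.e. I is the kernel of some *-representation of P on a complex inner product space) to its norm closure in A is a bijection from the set of closed *-ideals of P onto the set of norm-closed two-sided ideals of A, and for closed *-ideals I, I' of P one has I ⊆ I' if and only if the norm closure of I is contained in the norm closure of I'. -/

import Mathlib

open scoped ComplexInnerProductSpace ComplexOrder

/-- A *-representation of a (possibly non-unital) *-algebra `A` over `ℂ` on a complex
inner product space (pre-Hilbert space, not assumed complete). -/
structure StarRep (A : Type) [NonUnitalRing A] [Module ℂ A] [Star A] : Type 1 where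
  carrier : Type
  [nacg : NormedAddCommGroup carrier]
  [ips : InnerProductSpace ℂ carrier]
  toFun : A → carrier →ₗ[ℂ] carrier
  map_add' : ∀ a b : A, toFun (a + b) = toFun a + toFun b
  map_smul' : ∀ (c : ℂ) (a : A), toFun (c • a) = c • toFun a
  map_mul' : ∀ a b : A, toFun (a * b) = toFun a ∘ₗ toFun b
  star_rep' : ∀ (a : A) (x y : carrier), ⟪toFun a x, y⟫ = ⟪x, toFun (star a) y⟫

attribute [instance] StarRep.nacg StarRep.ips


section ClosedIdeal

variable {A : Type*} [NonUnitalCStarAlgebra A] {T : TwoSidedIdeal A}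

lemma TwoSidedIdeal.smul_mem_of_isClosed (hT : IsClosed (T : Set A)) (c : ℂ) {x : A}
    (hx : x ∈ T) : c • x ∈ T := by
  let _ := CStarAlgebra.spectralOrder A
  have _ := CStarAlgebra.spectralOrderedRing A
  have hu := CStarAlgebra.increasingApproximateUnit A
  have := hu.neBot
  have h1 : Filter.Tendsto (fun e : A => (c • e) * x) (CStarAlgebra.approximateUnit A)
      (nhds (c • x)) := by
    simpa only [smul_mul_assoc] using (hu.tendsto_mul_right x).const_smul c
  exact hT.mem_of_tendsto h1 (Filter.Eventually.of_forall fun e => T.mul_mem_left _ _ hx)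

/-- The element `e` is a continuous function of `k` that acts almost like a unit on `k`. -/
lemma TwoSidedIdeal.exists_approx_unit {k : A} (hk : k ∈ T) (hsa : IsSelfAdjoint k) {δ : ℝ}
    (hδ : 0 < δ) :
    ∃ e ∈ T, IsSelfAdjoint e ∧ ‖e‖ ≤ 1 ∧ ‖k - e * k - k * e + e * k * e‖ ≤ δ := by
  set s : ℝ := δ⁻¹
  have hs : 0 < s := inv_pos.mpr hδ
  have hpos : ∀ t : ℝ, 0 < 1 + s ^ 2 * t ^ 2 := fun t => by positivity
  have hne : ∀ t : ℝ, 1 + s ^ 2 * t ^ 2 ≠ 0 := fun t => (hpos t).ne'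
  have hg : Continuous fun t : ℝ => s ^ 2 * t / (1 + s ^ 2 * t ^ 2) :=
    Continuous.div (by fun_prop) (by fun_prop) hne
  have hf : Continuous fun t : ℝ => t * (s ^ 2 * t / (1 + s ^ 2 * t ^ 2)) := continuous_id.mul hg
  set f : ℝ → ℝ := fun t => t * (s ^ 2 * t / (1 + s ^ 2 * t ^ 2)) with f_def
  have hf0 : f 0 = 0 := by simp [f_def]
  refine ⟨cfcₙ f k, ?_, cfcₙ_predicate f k, ?_, ?_⟩
  · rw [f_def, cfcₙ_mul (fun t : ℝ => t) _ k, cfcₙ_id' ℝ k]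
    · exact T.mul_mem_right _ _ hk
  · refine norm_cfcₙ_le fun t _ => ?_
    have : 0 ≤ f t := by
      have : f t = s ^ 2 * t ^ 2 / (1 + s ^ 2 * t ^ 2) := by simp only [f_def]; ring
      rw [this]; positivity
    rw [Real.norm_of_nonneg this]
    have : f t = s ^ 2 * t ^ 2 / (1 + s ^ 2 * t ^ 2) := by simp only [f_def]; ring
    rw [this, div_le_one (hpos t)]
    linarith
  · have key : k - cfcₙ f k * k - k * cfcₙ f k + cfcₙ f k * k * cfcₙ f k
        = cfcₙ (fun t : ℝ => t - f t * t - t * f t + f t * t * f t) k := by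
      have hfc := hf.continuousOn (s := quasispectrum ℝ k)
      have hid : ContinuousOn (fun t : ℝ => t) (quasispectrum ℝ k) := continuousOn_id
      have h1 : ContinuousOn (fun t : ℝ => f t * t) (quasispectrum ℝ k) := hfc.mul hid
      have h2 : ContinuousOn (fun t : ℝ => t * f t) (quasispectrum ℝ k) := hid.mul hfc
      rw [cfcₙ_add (fun t => t - f t * t - t * f t) (fun t => f t * t * f t) k ((hid.sub h1).sub h2) (by simp)
          (h1.mul hfc) (by simp),
        cfcₙ_sub (fun t => t - f t * t) (fun t => t * f t) k (hid.sub h1) (by simp) h2 (by simp),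
        cfcₙ_sub (fun t => t) (fun t => f t * t) k hid (by simp) h1 (by simp),
        cfcₙ_mul (fun t => f t * t) _ k h1 (by simp) hfc hf0,
        cfcₙ_mul f _ k hfc hf0 hid rfl,
        cfcₙ_mul (fun t : ℝ => t) _ k hid rfl hfc hf0,
        cfcₙ_id' ℝ k]
    rw [key]
    refine norm_cfcₙ_le fun t _ => ?_
    have h1 : t - f t * t - t * f t + f t * t * f t = t / (1 + s ^ 2 * t ^ 2) ^ 2 := by
      simp only [f_def]
      field_simp [hne t]
      ring
    rw [h1, Real.norm_eq_abs, abs_div, abs_of_pos (pow_pos (hpos t) 2),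
      div_le_iff₀ (pow_pos (hpos t) 2)]
    have h2 : s * δ = 1 := inv_mul_cancel₀ hδ.ne'
    have h3 : |t| ≤ δ * (1 + s ^ 2 * t ^ 2) := by
      have h5 : δ * (1 + s ^ 2 * t ^ 2) = δ + s * t ^ 2 := by
        linear_combination s * t ^ 2 * h2
      rw [h5, ← sq_abs t]
      have h6 : 0 ≤ δ * (s * |t| - 1) ^ 2 := by positivity
      have h7 : δ * (s * |t| - 1) ^ 2 = s * |t| ^ 2 - 2 * |t| + δ := by
        linear_combination (s * |t| ^ 2 - 2 * |t|) * h2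
      nlinarith [abs_nonneg t]
    have h4 : δ * (1 + s ^ 2 * t ^ 2) ≤ δ * (1 + s ^ 2 * t ^ 2) ^ 2 := by
      gcongr
      nlinarith [mul_nonneg (sq_nonneg s) (sq_nonneg t)]
    linarith

lemma norm_compression_le {e : A} (he : ‖e‖ ≤ 1) (x : A) :
    ‖x - e * x - x * e + e * x * e‖ ≤ 4 * ‖x‖ := by
  have h1 : ‖e * x‖ ≤ ‖x‖ := (norm_mul_le _ _).trans (by nlinarith [norm_nonneg x])
  have h2 : ‖x * e‖ ≤ ‖x‖ := (norm_mul_le _ _).trans (by nlinarith [norm_nonneg x])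
  have h3 : ‖e * x * e‖ ≤ ‖x‖ :=
    (norm_mul_le _ _).trans (by nlinarith [norm_nonneg x, norm_nonneg (e * x)])
  have h4 := norm_add_le (x - e * x - x * e) (e * x * e)
  have h5 := norm_sub_le (x - e * x) (x * e)
  have h6 := norm_sub_le x (e * x)
  linarith

open ComplexStarModule in
/-- The complex-linear extension of a real functional, evaluated on real and imaginary parts. -/
noncomputable def hermitianExtension (f : A →ₗ[ℝ] ℝ) : A →ₗ[ℂ] ℂ where
  toFun a := (f (ℜ a : A) : ℂ) + Complex.I * (f (ℑ a : A) : ℂ)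
  map_add' a b := by
    simp only [map_add, AddSubgroup.coe_add, Complex.ofReal_add]
    ring
  map_smul' c a := by
    rw [realPart_smul, imaginaryPart_smul]
    simp only [AddSubgroup.coe_add, AddSubgroup.coe_sub, selfAdjoint.val_smul, map_add, map_sub,
      map_smul, smul_eq_mul, Complex.ofReal_add, Complex.ofReal_sub, Complex.ofReal_mul,
      RingHom.id_apply]
    conv_rhs => rw [← Complex.re_add_im c]
    linear_combination (- (c.im : ℂ) * (f (ℑ a : A) : ℂ)) * Complex.I_sq

open ComplexStarModule in
lemma hermitianExtension_apply_of_isSelfAdjoint (f : A →ₗ[ℝ] ℝ) {a : A} (ha : IsSelfAdjoint a) :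
    hermitianExtension f a = f a := by
  simp [hermitianExtension, imaginaryPart_eq_zero_iff.mpr ha, ha.coe_realPart]

variable [PartialOrder A] [StarOrderedRing A]

lemma compression_nonneg {e x : A} (he : IsSelfAdjoint e) (hx : 0 ≤ x) :
    0 ≤ x - e * x - x * e + e * x * e := by
  obtain ⟨w, rfl⟩ := CStarAlgebra.nonneg_iff_eq_star_mul_self.mp hx
  have : star w * w - e * (star w * w) - star w * w * e + e * (star w * w) * e
      = star (w - w * e) * (w - w * e) := by
    rw [star_sub, star_mul, he.star_eq]
    noncomm_ring
  rw [this]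
  exact star_mul_self_nonneg _

lemma TwoSidedIdeal.exists_norm_sub_mul_sq_le {x k r : A} (hk : k ∈ T) (hsa : IsSelfAdjoint k)
    (hle : x * star x ≤ k + r) {δ : ℝ} (hδ : 0 < δ) :
    ∃ e ∈ T, IsSelfAdjoint e ∧ ‖x - e * x‖ ^ 2 ≤ δ + 4 * ‖r‖ := by
  obtain ⟨e, heT, hesa, he1, hek⟩ := TwoSidedIdeal.exists_approx_unit hk hsa hδ
  refine ⟨e, heT, hesa, ?_⟩
  let c : A → A := fun x => x - e * x - x * e + e * x * e
  have hc : (x - e * x) * star (x - e * x) = c (x * star x) := by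
    simp only [c]
    rw [star_sub, star_mul, hesa.star_eq]
    noncomm_ring
  have h0 : 0 ≤ c (x * star x) := compression_nonneg hesa (mul_star_self_nonneg x)
  have h1 : c (x * star x) ≤ c (k + r) := by
    rw [← sub_nonneg]
    have : c (k + r) - c (x * star x) = c (k + r - x * star x) := by
      simp only [c]; noncomm_ring
    rw [this]
    exact compression_nonneg hesa (sub_nonneg.mpr hle)
  have h2 : c (k + r) = c k + c r := by simp only [c]; noncomm_ring
  calc ‖x - e * x‖ ^ 2 = ‖c (x * star x)‖ := by rw [← hc, CStarRing.norm_self_mul_star, sq]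
    _ ≤ ‖c (k + r)‖ := CStarAlgebra.norm_le_norm_of_nonneg_of_le h0 h1
    _ ≤ ‖c k‖ + ‖c r‖ := by rw [h2]; exact norm_add_le _ _
    _ ≤ δ + 4 * ‖r‖ := add_le_add hek (norm_compression_le he1 r)

/-- A closed ideal is hereditary, in an approximate form. -/
lemma TwoSidedIdeal.mem_of_forall_le_add (hT : IsClosed (T : Set A)) {x : A}
    (h : ∀ ε > 0, ∃ k ∈ T, ∃ r : A, IsSelfAdjoint k ∧ ‖r‖ ≤ ε ∧ x * star x ≤ k + r) :
    x ∈ T ∧ star x ∈ T := by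
  have key : ∀ ε > 0, ∃ e ∈ T, IsSelfAdjoint e ∧ ‖x - e * x‖ < ε := by
    intro ε hε
    obtain ⟨k, hk, r, hsa, hr, hle⟩ := h (ε ^ 2 / 16) (by positivity)
    obtain ⟨e, he, hesa, hle'⟩ :=
      TwoSidedIdeal.exists_norm_sub_mul_sq_le hk hsa hle (δ := ε ^ 2 / 2) (by positivity)
    refine ⟨e, he, hesa, lt_of_pow_lt_pow_left₀ 2 hε.le ?_⟩
    nlinarith [sq_pos_of_pos hε]
  constructor
  · rw [← SetLike.mem_coe, ← hT.closure_eq, Metric.mem_closure_iff]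
    intro ε hε
    obtain ⟨e, he, -, hlt⟩ := key ε hε
    exact ⟨e * x, T.mul_mem_right _ _ he, by rwa [dist_eq_norm]⟩
  · rw [← SetLike.mem_coe, ← hT.closure_eq, Metric.mem_closure_iff]
    intro ε hε
    obtain ⟨e, he, hesa, hlt⟩ := key ε hε
    refine ⟨star x * e, T.mul_mem_left _ _ he, ?_⟩
    rw [dist_eq_norm, ← norm_star]
    simpa [hesa.star_eq] using hlt

lemma TwoSidedIdeal.mem_and_star_mem_of_mul_star_mem (hT : IsClosed (T : Set A)) {x : A}
    (hx : x * star x ∈ T) : x ∈ T ∧ star x ∈ T :=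
  TwoSidedIdeal.mem_of_forall_le_add hT fun _ hε =>
    ⟨x * star x, hx, 0, .mul_star_self x, by simpa using hε.le, by simp⟩

lemma TwoSidedIdeal.star_mem_of_isClosed (hT : IsClosed (T : Set A)) {x : A}
    (hx : x ∈ T) : star x ∈ T :=
  (TwoSidedIdeal.mem_and_star_mem_of_mul_star_mem hT (T.mul_mem_right _ _ hx)).2

open ComplexStarModule in
lemma hermitianExtension_apply_of_mem (hT : IsClosed (T : Set A)) (f : A →ₗ[ℝ] ℝ)
    (hf : ∀ y ∈ T, f y = 0) {a : A} (ha : a ∈ T) : hermitianExtension f a = 0 := by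
  have hr (r : ℝ) {y : A} (hy : y ∈ T) : r • y ∈ T := by
    simpa using TwoSidedIdeal.smul_mem_of_isClosed hT (r : ℂ) hy
  have hs := TwoSidedIdeal.star_mem_of_isClosed hT ha
  have h1 : (ℜ a : A) ∈ T := by
    rw [realPart_apply_coe]
    exact hr _ (T.add_mem ha hs)
  have h2 : (ℑ a : A) ∈ T := by
    rw [imaginaryPart_apply_coe]
    exact TwoSidedIdeal.smul_mem_of_isClosed hT _ (hr _ (T.sub_mem ha hs))
  simp [hermitianExtension, hf _ h1, hf _ h2]

open ComplexStarModule in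
lemma TwoSidedIdeal.exists_positiveLinearMap_ne_zero (hT : IsClosed (T : Set A)) {x : A}
    (hx : x ∉ T) :
    ∃ φ : A →ₚ[ℂ] ℂ, (∀ y ∈ T, φ y = 0) ∧ φ (x * star x) ≠ 0 := by
  let J : Submodule ℂ A :=
    { carrier := T
      add_mem' := T.add_mem
      zero_mem' := T.zero_mem
      smul_mem' := fun c _ hx => TwoSidedIdeal.smul_mem_of_isClosed hT c hx }
  let K : PointedCone ℝ A :=
    PointedCone.positive ℝ A ⊔ PointedCone.ofSubmodule (J.restrictScalars ℝ)
  have hpos {b : A} (hb : 0 ≤ b) : b ∈ K := Submodule.mem_sup_left hb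
  have hJ {j : A} (hj : j ∈ T) : j ∈ K := Submodule.mem_sup_right hj
  have hK : -(x * star x) ∉ Submodule.closure K := by
    intro hmem
    refine hx (TwoSidedIdeal.mem_of_forall_le_add hT fun ε hε => ?_).1
    obtain ⟨y, hy, hlt⟩ := Metric.mem_closure_iff.mp hmem ε hε
    obtain ⟨b, hb, j, hj, rfl⟩ := Submodule.mem_sup.mp hy
    replace hb : 0 ≤ b := hb
    replace hj : j ∈ T := hj
    refine ⟨-(ℜ j : A), ?_, x * star x + b + (ℜ j : A), (ℜ j).2.neg, ?_, ?_⟩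
    · rw [realPart_apply_coe]
      exact T.neg_mem (J.smul_mem (((2 : ℝ)⁻¹ : ℝ) : ℂ)
        (T.add_mem hj (TwoSidedIdeal.star_mem_of_isClosed hT hj)))
    · have h1 : x * star x + b + (ℜ j : A) = (ℜ (x * star x + b + j) : A) := by
        simp [(IsSelfAdjoint.mul_star_self x).coe_realPart, hb.isSelfAdjoint.coe_realPart]
      rw [h1]
      refine (realPart.norm_le (x * star x + b + j)).trans ?_
      rw [dist_eq_norm, ← norm_neg] at hlt
      refine le_of_eq_of_le ?_ hlt.le
      congr 1
      abel
    · simpa using hb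
  obtain ⟨f, hf, hfx⟩ := ProperCone.hyperplane_separation_point _ hK
  have hfK {y : A} (hy : y ∈ K) : 0 ≤ f y := hf y (subset_closure hy)
  have hfT : ∀ y ∈ T, f y = 0 := fun y hy =>
    le_antisymm (by simpa using hfK (hJ (T.neg_mem hy))) (hfK (hJ hy))
  refine ⟨PositiveLinearMap.mk₀ (hermitianExtension (f : A →ₗ[ℝ] ℝ)) fun b hb => ?_,
    fun y hy => hermitianExtension_apply_of_mem hT _ hfT hy, ?_⟩
  · rw [hermitianExtension_apply_of_isSelfAdjoint _ hb.isSelfAdjoint]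
    exact Complex.zero_le_real.mpr (hfK (hpos hb))
  · change hermitianExtension (f : A →ₗ[ℝ] ℝ) (x * star x) ≠ 0
    rw [hermitianExtension_apply_of_isSelfAdjoint _ (.mul_star_self x)]
    have : 0 < f (x * star x) := by simpa using hfx
    exact_mod_cast this.ne'

lemma PositiveLinearMap.gnsNonUnitalStarAlgHom_eq_zero (φ : A →ₚ[ℂ] ℂ)
    (hφ : ∀ y ∈ T, φ y = 0) {a : A} (ha : a ∈ T) : φ.gnsNonUnitalStarAlgHom a = 0 := by
  ext y
  induction y using UniformSpace.Completion.induction_on with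
  | hp => exact isClosed_eq (φ.gnsNonUnitalStarAlgHom a).continuous continuous_const
  | ih b =>
    rw [gnsNonUnitalStarAlgHom_apply_coe, _root_.zero_apply,
      ← norm_eq_zero, UniformSpace.Completion.norm_coe, preGNS_norm_def]
    simp only [leftMulMapPreGNS_apply]
    rw [hφ, Complex.zero_re, Real.sqrt_zero]
    exact T.mul_mem_left _ _ (T.mul_mem_right _ _ ha)

lemma PositiveLinearMap.apply_eq_zero_of_gnsNonUnitalStarAlgHom_eq_zero (φ : A →ₚ[ℂ] ℂ) {a : A}
    (ha : φ.gnsNonUnitalStarAlgHom a = 0) (b : A) : φ (star (a * b) * (a * b)) = 0 := by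
  have h : (φ.gnsNonUnitalStarAlgHom a) (φ.toPreGNS b : φ.GNS) = 0 := by rw [ha]; rfl
  rw [gnsNonUnitalStarAlgHom_apply_coe, ← norm_eq_zero, UniformSpace.Completion.norm_coe] at h
  have := preGNS_norm_sq φ (φ.leftMulMapPreGNS a (φ.toPreGNS b))
  rw [h] at this
  simpa using this.symm

end ClosedIdeal

section Pedersen

variable {A : Type} [NonUnitalCStarAlgebra A]

/-- A quadratic equation solved inside an ideal: `h = 2 s k - k ^ 2`, i.e. `k = s - √(s ^ 2 - h)`. -/
lemma exists_isSelfAdjoint_quadratic {P : NonUnitalStarSubalgebra ℂ A}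
    (hP : ∀ a ∈ P, ∀ b : A, a * b ∈ P ∧ b * a ∈ P) {h : A} (hh : h ∈ P) (hsa : IsSelfAdjoint h)
    {s : ℝ} (hs : 0 < s) (hle : ‖h‖ ≤ s ^ 2) :
    ∃ k ∈ P, IsSelfAdjoint k ∧ h = ((2 * s : ℝ) : ℂ) • k - k * k := by
  set f : ℝ → ℝ := fun t => s - √(s ^ 2 - t) with f_def
  have hf : Continuous f := by fun_prop
  have hf0 : f 0 = 0 := by simp [f_def, Real.sqrt_sq hs.le]
  set g : ℝ → ℝ := fun t => (s + √(s ^ 2 - t))⁻¹ - (2 * s)⁻¹ with g_def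
  have hpos : ∀ t : ℝ, s + √(s ^ 2 - t) ≠ 0 := fun t => by positivity
  have hg : Continuous g := ((by fun_prop : Continuous _).inv₀ hpos).sub continuous_const
  have hg0 : g 0 = 0 := by simp [g_def, Real.sqrt_sq hs.le, two_mul]
  have hspec : ∀ t ∈ quasispectrum ℝ h, √(s ^ 2 - t) ^ 2 = s ^ 2 - t := fun t ht =>
    Real.sq_sqrt (sub_nonneg.mpr
      ((le_abs_self t).trans ((NonUnitalIsometricContinuousFunctionalCalculus.norm_quasispectrum_le h ht).trans hle)))
  have hid : ContinuousOn (fun t : ℝ => t) (quasispectrum ℝ h) := continuousOn_id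
  have hfc := hf.continuousOn (s := quasispectrum ℝ h)
  have hgc := hg.continuousOn (s := quasispectrum ℝ h)
  refine ⟨cfcₙ f h, ?_, cfcₙ_predicate f h, ?_⟩
  · have : cfcₙ f h = ((2 * s)⁻¹ : ℝ) • h + h * cfcₙ g h := by
      have hmul := cfcₙ_mul (fun t : ℝ => t) g h hid rfl hgc hg0
      rw [cfcₙ_id' ℝ h] at hmul
      rw [← cfcₙ_const_mul_id (2 * s)⁻¹ h, ← hmul, ← cfcₙ_add (fun t : ℝ => (2 * s)⁻¹ * t) (fun t => t * g t) h
          (by fun_prop) (by simp) (hid.mul hgc) (by simp)]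
      refine cfcₙ_congr fun t ht => ?_
      have h1 := hspec t ht
      have h2 := hpos t
      simp only [f_def, g_def]
      field_simp
      linear_combination (-(2 * s)) * h1
    rw [this]
    exact P.add_mem (P.smul_mem (((2 * s)⁻¹ : ℝ) : ℂ) hh) (hP h hh _).1
  · have hsf : ContinuousOn (fun t => (2 * s) • f t) (quasispectrum ℝ h) :=
      continuousOn_const.mul hfc
    rw [Complex.coe_smul, ← cfcₙ_mul f f h hfc hf0 hfc hf0, ← cfcₙ_smul (2 * s) f h hfc hf0,
      ← cfcₙ_sub (fun t => (2 * s) • f t) (fun t => f t * f t) h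
        hsf (by simp [hf0]) (hfc.mul hfc) (by simp [hf0])]
    conv_lhs => rw [← cfcₙ_id' ℝ h]
    refine cfcₙ_congr fun t ht => ?_
    have h1 := hspec t ht
    simp only [f_def, smul_eq_mul]
    linear_combination h1

namespace StarRep

lemma map_zero {B : Type} [NonUnitalRing B] [Module ℂ B] [Star B] (R : StarRep B) :
    R.toFun 0 = 0 := by
  simpa using R.map_smul' 0 0

lemma map_sub {B : Type} [NonUnitalRing B] [Module ℂ B] [Star B] (R : StarRep B) (a b : B) :
    R.toFun (a - b) = R.toFun a - R.toFun b := by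
  have := R.map_add' (a - b) b
  rw [sub_add_cancel] at this
  rw [this, add_sub_cancel_right]

variable {P : NonUnitalStarSubalgebra ℂ A}

/-- A representation of a *-ideal on a pre-Hilbert space is automatically contractive. -/
lemma norm_apply_le (hP : ∀ a ∈ P, ∀ b : A, a * b ∈ P ∧ b * a ∈ P) (R : StarRep P) (p : P)
    (x : R.carrier) : ‖R.toFun p x‖ ≤ ‖(p : A)‖ * ‖x‖ := by
  rcases eq_or_ne p 0 with rfl | hp
  · simp [R.map_zero]
  have hs : 0 < ‖(p : A)‖ := by simpa using hp
  set s := ‖(p : A)‖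
  obtain ⟨k, hk, hksa, hkeq⟩ := exists_isSelfAdjoint_quadratic hP (h := star (p : A) * p)
    (star p * p).2 (.star_mul_self _) hs (by rw [CStarRing.norm_star_mul_self, sq])
  set q : P := ⟨k, hk⟩
  have hq : star q = q := Subtype.ext hksa.star_eq
  have heq : star p * p = ((2 * s : ℝ) : ℂ) • q - q * q := Subtype.ext hkeq
  have h1 : R.toFun (star p) (R.toFun p x)
      = ((2 * s : ℝ) : ℂ) • R.toFun q x - R.toFun q (R.toFun q x) := by
    rw [← LinearMap.comp_apply, ← R.map_mul', heq, R.map_sub, R.map_smul', R.map_mul']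
    rfl
  have h2 : (‖R.toFun p x‖ ^ 2 : ℝ) = 2 * s * (⟪x, R.toFun q x⟫).re - ‖R.toFun q x‖ ^ 2 := by
    have e1 : ⟪R.toFun p x, R.toFun p x⟫ = ⟪x, R.toFun (star p) (R.toFun p x)⟫ :=
      R.star_rep' p x _
    have e2 : ⟪R.toFun q x, R.toFun q x⟫ = ⟪x, R.toFun q (R.toFun q x)⟫ := by
      conv_rhs => rw [← hq]
      rw [R.star_rep' q x, hq]
    rw [h1, inner_sub_right, inner_smul_right, ← e2, inner_self_eq_norm_sq_to_K,
      inner_self_eq_norm_sq_to_K] at e1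
    have := congrArg Complex.re e1
    simpa [← Complex.ofReal_pow] using this
  have h3 : ‖(s : ℂ) • x - R.toFun q x‖ ^ 2
      = s ^ 2 * ‖x‖ ^ 2 - 2 * s * (⟪x, R.toFun q x⟫).re + ‖R.toFun q x‖ ^ 2 := by
    rw [norm_sub_sq (𝕜 := ℂ), norm_smul, inner_smul_left]
    simp [abs_of_pos hs, mul_pow]
    ring
  have h4 : ‖R.toFun p x‖ ^ 2 ≤ (s * ‖x‖) ^ 2 := by
    rw [mul_pow]
    linarith [sq_nonneg ‖(s : ℂ) • x - R.toFun q x‖]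
  exact le_of_sq_le_sq h4 (by positivity)

lemma mem_ker_of_mem_closure (hP : ∀ a ∈ P, ∀ b : A, a * b ∈ P ∧ b * a ∈ P) (R : StarRep P)
    {p : P} (hp : (p : A) ∈ closure ((↑) '' {q : P | R.toFun q = 0} : Set A)) :
    R.toFun p = 0 := by
  ext x
  rw [LinearMap.zero_apply, ← norm_le_zero_iff]
  refine le_of_forall_pos_le_add fun ε hε => ?_
  obtain ⟨_, ⟨q, hq, rfl⟩, hlt⟩ := Metric.mem_closure_iff.mp hp (ε / (‖x‖ + 1)) (by positivity)
  replace hq : R.toFun q = 0 := hq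
  have h1 := R.norm_apply_le hP (p - q) x
  rw [R.map_sub, hq, sub_zero] at h1
  rw [dist_eq_norm] at hlt
  have h2 : ‖((p - q : P) : A)‖ * ‖x‖ ≤ ε / (‖x‖ + 1) * (‖x‖ + 1) := by
    gcongr
    · exact hlt.le
    · linarith
  rw [div_mul_cancel₀ _ (by positivity)] at h2
  linarith

lemma exists_twoSidedIdeal_eq_closure_ker (hd : Dense (P : Set A)) (R : StarRep P) :
    ∃ T : TwoSidedIdeal A,
      closure ((↑) '' {q : P | R.toFun q = 0} : Set A) = (T : Set A) := by
  set S : Set A := (↑) '' {q : P | R.toFun q = 0}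
  have hadd : ∀ x ∈ S, ∀ y ∈ S, x + y ∈ S := by
    rintro _ ⟨p, hp, rfl⟩ _ ⟨q, hq, rfl⟩
    refine ⟨p + q, ?_, rfl⟩
    rw [Set.mem_ofPred_eq] at hp hq ⊢
    rw [R.map_add', hp, hq, add_zero]
  have hneg : ∀ x ∈ S, -x ∈ S := by
    rintro _ ⟨p, hp, rfl⟩
    refine ⟨-p, ?_, rfl⟩
    rw [Set.mem_ofPred_eq] at hp ⊢
    rw [← zero_sub, R.map_sub, hp, R.map_zero, sub_zero]
  have hleft : ∀ x ∈ (P : Set A), ∀ y ∈ S, x * y ∈ S := by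
    rintro x hx _ ⟨q, hq, rfl⟩
    refine ⟨⟨x, hx⟩ * q, ?_, rfl⟩
    rw [Set.mem_ofPred_eq] at hq ⊢
    rw [R.map_mul', hq, LinearMap.comp_zero]
  have hright : ∀ y ∈ S, ∀ x ∈ (P : Set A), y * x ∈ S := by
    rintro _ ⟨q, hq, rfl⟩ x hx
    refine ⟨q * ⟨x, hx⟩, ?_, rfl⟩
    rw [Set.mem_ofPred_eq] at hq ⊢
    rw [R.map_mul', hq, LinearMap.zero_comp]
  refine ⟨.mk' (closure S) (subset_closure ⟨0, R.map_zero, rfl⟩)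
    (fun hx hy => map_mem_closure₂ continuous_add hx hy hadd)
    (fun hx => map_mem_closure continuous_neg hx hneg)
    (fun {x y} hy => map_mem_closure₂ continuous_mul (hd x) hy hleft)
    (fun {x y} hx => map_mem_closure₂ continuous_mul hx (hd y) hright), ?_⟩
  rw [TwoSidedIdeal.coe_mk']

end StarRep

/-- The direct sum of a family of representations of `A` on Hilbert spaces, restricted to `P`. -/
noncomputable def StarRep.directSum (P : NonUnitalStarSubalgebra ℂ A) {ι : Type} (H : ι → Type)
    [∀ i, NormedAddCommGroup (H i)] [∀ i, InnerProductSpace ℂ (H i)] [∀ i, CompleteSpace (H i)]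
    (π : ∀ i, A →⋆ₙₐ[ℂ] (H i →L[ℂ] H i)) : StarRep P where
  carrier := lp H 2
  toFun a :=
    { toFun := fun x => ⟨fun i => π i a (x i),
        ((lp.memℓp x).const_smul (‖(a : A)‖ : ℂ)).mono' fun i => by
          refine ((π i a).le_opNorm _).trans ?_
          rw [Pi.smul_apply, norm_smul, Complex.norm_real, norm_norm]
          gcongr
          exact NonUnitalStarAlgHom.norm_apply_le (π i) (a : A)⟩
      map_add' := fun x y => by ext i; exact map_add (π i a) (x i) (y i)
      map_smul' := fun c x => by ext i; simp }
  map_add' a b := by ext x i; exact congrArg (fun F : H i →L[ℂ] H i => F (x i)) (map_add (π i) (a : A) b)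
  map_smul' c a := by ext x i; simp
  map_mul' a b := by ext x i; simp
  star_rep' a x y := by
    rw [lp.inner_eq_tsum, lp.inner_eq_tsum]
    refine tsum_congr fun i => ?_
    change ⟪π i a (x i), y i⟫ = ⟪x i, π i (star (a : A)) (y i)⟫
    rw [map_star, ContinuousLinearMap.star_eq_adjoint, ContinuousLinearMap.adjoint_inner_right]

lemma StarRep.directSum_eq_zero_iff (P : NonUnitalStarSubalgebra ℂ A) {ι : Type} (H : ι → Type)
    [∀ i, NormedAddCommGroup (H i)] [∀ i, InnerProductSpace ℂ (H i)] [∀ i, CompleteSpace (H i)]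
    (π : ∀ i, A →⋆ₙₐ[ℂ] (H i →L[ℂ] H i)) (p : P) :
    (StarRep.directSum P H π).toFun p = 0 ↔ ∀ i, π i p = 0 := by
  classical
  constructor
  · intro h i
    ext v
    have h1 : (StarRep.directSum P H π).toFun p (lp.single 2 i v : lp H 2) = (0 : lp H 2) :=
      LinearMap.congr_fun h _
    have h2 : π i p ((lp.single 2 i v : lp H 2) i) = 0 :=
      congrArg (fun x : lp H 2 => (x : ∀ i, H i) i) h1
    simpa using h2
  · intro h
    refine LinearMap.ext fun (x : lp H 2) => ?_
    refine lp.ext (funext fun i => ?_)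
    change π i p (x i) = 0
    rw [h i]
    rfl

lemma exists_starRep_ker_eq (P : NonUnitalStarSubalgebra ℂ A) {T : TwoSidedIdeal A}
    (hT : IsClosed (T : Set A)) :
    ∃ R : StarRep P, {p : P | (p : A) ∈ T} = {p : P | R.toFun p = 0} := by
  let _ := CStarAlgebra.spectralOrder A
  have _ := CStarAlgebra.spectralOrderedRing A
  have hex : ∀ a : {a : A // a ∉ T}, ∃ φ : A →ₚ[ℂ] ℂ, (∀ y ∈ T, φ y = 0) ∧
      φ (star ((a : A) * star (a : A)) * ((a : A) * star (a : A))) ≠ 0 := by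
    rintro ⟨a, ha⟩
    obtain ⟨φ, h0, h1⟩ := TwoSidedIdeal.exists_positiveLinearMap_ne_zero hT (x := a * star a)
      fun h => ha (TwoSidedIdeal.mem_and_star_mem_of_mul_star_mem hT h).1
    exact ⟨φ, h0, by simpa using h1⟩
  choose φ h0 h1 using hex
  refine ⟨StarRep.directSum P (fun a => (φ a).GNS) (fun a => (φ a).gnsNonUnitalStarAlgHom), ?_⟩
  ext p
  rw [Set.mem_ofPred_eq, Set.mem_ofPred_eq, StarRep.directSum_eq_zero_iff]
  constructor
  · exact fun hp a => (φ a).gnsNonUnitalStarAlgHom_eq_zero (h0 a) hp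
  · intro h
    by_contra hp
    exact h1 ⟨p, hp⟩
      ((φ _).apply_eq_zero_of_gnsNonUnitalStarAlgHom_eq_zero (h ⟨p, hp⟩) (star (p : A)))

lemma closure_inter_eq {P : NonUnitalStarSubalgebra ℂ A}
    (hP : ∀ a ∈ P, ∀ b : A, a * b ∈ P ∧ b * a ∈ P) (hd : Dense (P : Set A))
    {T : TwoSidedIdeal A} (hT : IsClosed (T : Set A)) :
    closure ((↑) '' {p : P | (p : A) ∈ T} : Set A) = T := by
  refine subset_antisymm (hT.closure_subset_iff.mpr ?_) fun x hx => ?_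
  · rintro _ ⟨p, hp, rfl⟩
    exact hp
  let _ := CStarAlgebra.spectralOrder A
  have _ := CStarAlgebra.spectralOrderedRing A
  have hu := CStarAlgebra.increasingApproximateUnit A
  have := hu.neBot
  refine isClosed_closure.mem_of_tendsto (hu.tendsto_mul_right x)
    (Filter.Eventually.of_forall fun e => ?_)
  refine map_mem_closure (f := fun y => y * x) (by fun_prop) (hd e) fun y hy => ?_
  exact ⟨⟨y * x, (hP y hy x).1⟩, T.mul_mem_left _ _ hx, rfl⟩

end Pedersen

/-- Let `A` be a (possibly non-unital) C*-algebra and `P` its Pedersen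
ideal.  The map sending a closed *-ideal `I` of the *-algebra `P` (a kernel of a
*-representation of `P`) to its norm closure in `A` is a bijection onto the set of
norm-closed two-sided ideals of `A`, and it preserves and reflects inclusions. -/
theorem stmt8 {A : Type} [NonUnitalCStarAlgebra A]
    (P : NonUnitalStarSubalgebra ℂ A)
    (hPideal : ∀ a ∈ P, ∀ b : A, a * b ∈ P ∧ b * a ∈ P)
    (hPdense : Dense (P : Set A))
    (hPmin : ∀ I : TwoSidedIdeal A, Dense (I : Set A) → (P : Set A) ⊆ (I : Set A)) :
    Set.BijOn (fun I : Set P => closure ((↑) '' I : Set A))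
      {I : Set P | ∃ R : StarRep P, I = {p : P | R.toFun p = 0}}
      {J : Set A | IsClosed J ∧ ∃ T : TwoSidedIdeal A, J = (T : Set A)} ∧
    (∀ I I' : Set P,
      (∃ R : StarRep P, I = {p : P | R.toFun p = 0}) →
      (∃ R : StarRep P, I' = {p : P | R.toFun p = 0}) →
      (I ⊆ I' ↔ closure ((↑) '' I : Set A) ⊆ closure ((↑) '' I' : Set A))) := by
  have hker : ∀ (R : StarRep P) (p : P),
      R.toFun p = 0 ↔ (p : A) ∈ closure ((↑) '' {q : P | R.toFun q = 0} : Set A) := fun R p =>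
    ⟨fun hp => subset_closure ⟨p, hp, rfl⟩, R.mem_ker_of_mem_closure hPideal⟩
  have hmono : ∀ I I' : Set P,
      (∃ R : StarRep P, I = {p : P | R.toFun p = 0}) →
      (∃ R : StarRep P, I' = {p : P | R.toFun p = 0}) →
      (I ⊆ I' ↔ closure ((↑) '' I : Set A) ⊆ closure ((↑) '' I' : Set A)) := by
    rintro _ _ ⟨R, rfl⟩ ⟨R', rfl⟩
    refine ⟨fun h => closure_mono (Set.image_mono h), fun h p hp => ?_⟩
    exact (hker R' p).mpr (h ((hker R p).mp hp))
  refine ⟨⟨?_, ?_, ?_⟩, hmono⟩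
  · rintro _ ⟨R, rfl⟩
    exact ⟨isClosed_closure, R.exists_twoSidedIdeal_eq_closure_ker hPdense⟩
  · intro I hI I' hI' h
    exact subset_antisymm ((hmono I I' hI hI').mpr h.subset) ((hmono I' I hI' hI).mpr h.superset)
  · rintro _ ⟨hT, T, rfl⟩
    exact ⟨{p : P | (p : A) ∈ T}, exists_starRep_ker_eq P hT, closure_inter_eq hPideal hPdense hT⟩
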